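/- arXiv:1707.00057 — 4 statements merged into one kernel-verified Lean document; each statement's English description precedes it below -/
import Mathlib

section
/- Let u : ℝ → ℝ be four times continuously differentiable on [a, b] with a < b. Then |(u''(a) + u''(b))/2 − (u'(b) − u'(a))/(b − a)| ≤ ((b − a)/8) · ∫_a^b |u''''(t)| dt. -/
open Set intervalIntegral in
/-- Peano kernel form of the error of the trapezoidal rule applied to `f₁`, where `f` has
successive derivatives `f₁`, `f₂`, `f₃` on `[a, b]`. -/
theorem integral_trapezoid_peano_kernel_mul {a b : ℝ} (hab : a ≤ b) {f f₁ f₂ f₃ : ℝ → ℝ}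
    (hf : ∀ t ∈ Icc a b, HasDerivWithinAt f (f₁ t) (Icc a b) t)
    (hf₁ : ∀ t ∈ Icc a b, HasDerivWithinAt f₁ (f₂ t) (Icc a b) t)
    (hf₂ : ∀ t ∈ Icc a b, HasDerivWithinAt f₂ (f₃ t) (Icc a b) t)
    (hf₃ : ContinuousOn f₃ (Icc a b)) :
    ∫ t in a..b, (t - a) * (b - t) / 2 * f₃ t =
      (b - a) * ((f₁ a + f₁ b) / 2) - (f b - f a) := by
  have hderiv : ∀ t ∈ Icc a b, HasDerivWithinAt
      (fun t => (t - a) * (b - t) / 2 * f₂ t + (t - (a + b) / 2) * f₁ t - f t)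
      ((t - a) * (b - t) / 2 * f₃ t) (Icc a b) t := by
    intro t ht
    have hid := hasDerivWithinAt_id t (Icc a b)
    convert! (((((hid.sub_const a).mul (hid.const_sub b)).div_const 2).mul (hf₂ t ht)).add
      ((hid.sub_const ((a + b) / 2)).mul (hf₁ t ht))).sub (hf t ht) using 1
    simp only [id, Pi.mul_apply]
    ring
  rw [integral_eq_sub_of_hasDerivAt_of_le hab
    (fun t ht => (hderiv t ht).continuousWithinAt)
    (fun t ht => (hderiv t (Ioo_subset_Icc_self ht)).hasDerivAt (Icc_mem_nhds ht.1 ht.2))]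
  · ring
  · refine ContinuousOn.intervalIntegrable_of_Icc hab ?_
    fun_prop

open Set intervalIntegral in
/-- The gap between the mean of the endpoint derivatives of `f` and its slope over `[a, b]` is
controlled by the `L¹` norm of its third derivative. -/
theorem abs_trapezoid_sub_slope_le {a b : ℝ} (hab : a < b) {f f₁ f₂ f₃ : ℝ → ℝ}
    (hf : ∀ t ∈ Icc a b, HasDerivWithinAt f (f₁ t) (Icc a b) t)
    (hf₁ : ∀ t ∈ Icc a b, HasDerivWithinAt f₁ (f₂ t) (Icc a b) t)
    (hf₂ : ∀ t ∈ Icc a b, HasDerivWithinAt f₂ (f₃ t) (Icc a b) t)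
    (hf₃ : ContinuousOn f₃ (Icc a b)) :
    |(f₁ a + f₁ b) / 2 - (f b - f a) / (b - a)| ≤ (b - a) / 8 * ∫ t in a..b, |f₃ t| := by
  have hpos : 0 < b - a := sub_pos.2 hab
  have hbound : |∫ t in a..b, (t - a) * (b - t) / 2 * f₃ t| ≤
      ∫ t in a..b, (b - a) ^ 2 / 8 * |f₃ t| := by
    refine (abs_integral_le_integral_abs hab.le).trans (integral_mono_on hab.le ?_ ?_ ?_)
    · exact ContinuousOn.intervalIntegrable_of_Icc hab.le (by fun_prop)
    · exact ContinuousOn.intervalIntegrable_of_Icc hab.le (by fun_prop)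
    · intro t ht
      have hker : 0 ≤ (t - a) * (b - t) / 2 :=
        div_nonneg (mul_nonneg (sub_nonneg.2 ht.1) (sub_nonneg.2 ht.2)) zero_le_two
      rw [abs_mul, abs_of_nonneg hker]
      refine mul_le_mul_of_nonneg_right ?_ (abs_nonneg _)
      nlinarith [sq_nonneg (2 * t - a - b)]
  rw [integral_trapezoid_peano_kernel_mul hab.le hf hf₁ hf₂ hf₃, integral_const_mul] at hbound
  have hfactor : (b - a) * ((f₁ a + f₁ b) / 2) - (f b - f a) =
      (b - a) * ((f₁ a + f₁ b) / 2 - (f b - f a) / (b - a)) := by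
    field_simp
  rw [hfactor, abs_mul, abs_of_pos hpos] at hbound
  refine le_of_mul_le_mul_left (hbound.trans_eq ?_) hpos
  ring

/-- consistency estimate for the residual `R₂`. If `u` is four times
continuously differentiable on `[a, b]` with `a < b`, then
`|(u''(a) + u''(b))/2 − (u'(b) − u'(a))/(b − a)| ≤ ((b − a)/8) ∫_a^b |u''''(t)| dt`. -/
theorem trapezoid_consistency_fourth_derivative
    (a b : ℝ) (hab : a < b) (u : ℝ → ℝ)
    (hu : ContDiffOn ℝ 4 u (Set.Icc a b)) :
    |(iteratedDerivWithin 2 u (Set.Icc a b) a + iteratedDerivWithin 2 u (Set.Icc a b) b) / 2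
        - (derivWithin u (Set.Icc a b) b - derivWithin u (Set.Icc a b) a) / (b - a)|
      ≤ ((b - a) / 8) * ∫ t in a..b, |iteratedDerivWithin 4 u (Set.Icc a b) t| := by
  have huniq := uniqueDiffOn_Icc hab
  have hderiv : ∀ k : ℕ, k < 4 → ∀ t ∈ Set.Icc a b,
      HasDerivWithinAt (iteratedDerivWithin k u (Set.Icc a b))
        (iteratedDerivWithin (k + 1) u (Set.Icc a b) t) (Set.Icc a b) t := by
    intro k hk t ht
    rw [iteratedDerivWithin_succ]
    exact (hu.differentiableOn_iteratedDerivWithin (by exact_mod_cast hk) huniq t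
      ht).hasDerivWithinAt
  rw [← iteratedDerivWithin_one]
  exact abs_trapezoid_sub_slope_le hab (hderiv 1 (by norm_num)) (hderiv 2 (by norm_num))
    (hderiv 3 (by norm_num)) (hu.continuousOn_iteratedDerivWithin le_rfl huniq)
end

section
/- Suppose the real sequences (u^n), (v^n), (f^n) satisfy the scalar Crank–Nicolson scheme. Fix n ≥ 1 and define on [t_n, t_{n+1}] the quadratic reconstructions ũ(t) = u^{n+1} + (t − t_{n+1})∂_{n+1/2}u + ½(t − t_{n+1})(t − t_n)∂²_n u, ṽ(t) = v^{n+1} + (t − t_{n+1})∂_{n+1/2}v + ½(t − t_{n+1})(t − t_n)∂²_n v, f̃(t) = f^{n+1} + (t − t_{n+1})∂_{n+1/2}f + ½(t − t_{n+1})(t − t_n)∂²_n f, and p_n(t) = (τ_{n−1}/2)(t − (t_n + t_{n+1})/2) + ½(t − t_{n+1})(t − t_n). Then for every t ∈ [t_n, t_{n+1}]: ũ'(t) − ṽ(t) = −p_n(t)·∂²_n v and ṽ'(t) + A·ũ(t) = f̃(t) + p_n(t)·(A·∂²_n u − ∂²_n f). -/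
/-- Second divided-difference operator `∂²_n w` for a scalar sequence with
variable time steps: `∂²_n w = ((w^{n+1} − w^n)/τ_n − (w^n − w^{n−1})/τ_{n−1})/τ_{n−1/2}`
with `τ_{n−1/2} = (τ_n + τ_{n−1})/2`. -/
noncomputable def secondDiff (τ : ℕ → ℝ) (w : ℕ → ℝ) (n : ℕ) : ℝ :=
  ((w (n + 1) - w n) / τ n - (w n - w (n - 1)) / τ (n - 1)) / ((τ n + τ (n - 1)) / 2)

/-- The polynomial `p_n(t) = (τ_{n−1}/2)(t − (t_n + t_{n+1})/2) + ½(t − t_{n+1})(t − t_n)`. -/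
noncomputable def pPoly (τ : ℕ → ℝ) (t : ℕ → ℝ) (n : ℕ) (s : ℝ) : ℝ :=
  (τ (n - 1) / 2) * (s - (t n + t (n + 1)) / 2) + (1 / 2) * (s - t (n + 1)) * (s - t n)

/-- If the difference quotients of `w` are the averages of consecutive values of `z`, then the
second divided difference of `w` is a corrected first divided difference of `z`. -/
theorem secondDiff_eq_of_slope_eq_average {τ : ℕ → ℝ} (hτ : ∀ n, 0 < τ n) {w z : ℕ → ℝ}
    (h : ∀ n, (w (n + 1) - w n) / τ n = (z n + z (n + 1)) / 2) {n : ℕ} (hn : 1 ≤ n) :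
    secondDiff τ w n = (z (n + 1) - z n) / τ n - τ (n - 1) / 2 * secondDiff τ z n := by
  obtain ⟨m, rfl⟩ := Nat.exists_eq_add_of_le' hn
  have h₀ := hτ m
  have h₁ := hτ (m + 1)
  have h₂ : τ (m + 1) + τ m ≠ 0 := by positivity
  simp only [secondDiff, Nat.add_sub_cancel, h]
  field_simp
  ring

theorem hasDerivAt_quadratic_reconstruction (a b c p q s : ℝ) :
    HasDerivAt (fun x : ℝ => a + (x - q) * b + (1 / 2) * (x - q) * (x - p) * c)
      (b + (s - (p + q) / 2) * c) s := by
  have hq := (hasDerivAt_id s).sub_const q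
  have hp := (hasDerivAt_id s).sub_const p
  refine (((hq.mul_const b).const_add a).add
    (((hq.const_mul (1 / 2)).mul hp).mul_const c)).congr_deriv ?_
  simp only [id]
  ring

/-- The residual of the quadratic reconstructions when `z` is the rate of change of `w` in the averaged sense. -/
theorem deriv_quadratic_reconstruction_sub {τ t : ℕ → ℝ} (hτ : ∀ n, 0 < τ n)
    (ht : ∀ n, t (n + 1) = t n + τ n) {w z : ℕ → ℝ}
    (h : ∀ n, (w (n + 1) - w n) / τ n = (z n + z (n + 1)) / 2) {n : ℕ} (hn : 1 ≤ n) (s : ℝ) :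
    deriv (fun x : ℝ => w (n + 1) + (x - t (n + 1)) * ((w (n + 1) - w n) / τ n)
            + (1 / 2) * (x - t (n + 1)) * (x - t n) * secondDiff τ w n) s
          - (z (n + 1) + (s - t (n + 1)) * ((z (n + 1) - z n) / τ n)
            + (1 / 2) * (s - t (n + 1)) * (s - t n) * secondDiff τ z n)
        = - pPoly τ t n s * secondDiff τ z n := by
  have h₁ := (hτ n).ne'
  rw [(hasDerivAt_quadratic_reconstruction _ _ _ _ _ s).deriv,
    secondDiff_eq_of_slope_eq_average hτ h hn, h n, pPoly, ht n]
  field_simp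
  ring

theorem secondDiff_sub_const_mul (τ f u : ℕ → ℝ) (A : ℝ) (n : ℕ) :
    secondDiff τ (fun k => f k - A * u k) n = secondDiff τ f n - A * secondDiff τ u n := by
  simp only [secondDiff]
  ring

/-- residual identities for the quadratic reconstruction of the scalar
Crank–Nicolson (Newmark) solution: on `[t_n, t_{n+1}]`, `n ≥ 1`,
`ũ'(t) − ṽ(t) = −p_n(t)·∂²_n v` and `ṽ'(t) + A·ũ(t) = f̃(t) + p_n(t)(A·∂²_n u − ∂²_n f)`. -/
theorem quadratic_reconstruction_residual
    (A : ℝ) (hA : 0 < A)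
    (τ : ℕ → ℝ) (hτ : ∀ n, 0 < τ n)
    (t : ℕ → ℝ) (ht0 : t 0 = 0) (htrec : ∀ n, t (n + 1) = t n + τ n)
    (u v f : ℕ → ℝ)
    (hCN1 : ∀ n, (u (n + 1) - u n) / τ n = (v n + v (n + 1)) / 2)
    (hCN2 : ∀ n, (v (n + 1) - v n) / τ n + A * (u (n + 1) + u n) / 2
              = (f (n + 1) + f n) / 2)
    (n : ℕ) (hn : 1 ≤ n) :
    ∀ s ∈ Set.Icc (t n) (t (n + 1)),
      (deriv (fun x : ℝ => u (n + 1) + (x - t (n + 1)) * ((u (n + 1) - u n) / τ n)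
            + (1 / 2) * (x - t (n + 1)) * (x - t n) * secondDiff τ u n) s
          - (v (n + 1) + (s - t (n + 1)) * ((v (n + 1) - v n) / τ n)
            + (1 / 2) * (s - t (n + 1)) * (s - t n) * secondDiff τ v n)
        = - pPoly τ t n s * secondDiff τ v n)
      ∧ (deriv (fun x : ℝ => v (n + 1) + (x - t (n + 1)) * ((v (n + 1) - v n) / τ n)
            + (1 / 2) * (x - t (n + 1)) * (x - t n) * secondDiff τ v n) s
          + A * (u (n + 1) + (s - t (n + 1)) * ((u (n + 1) - u n) / τ n)
            + (1 / 2) * (s - t (n + 1)) * (s - t n) * secondDiff τ u n)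
        = (f (n + 1) + (s - t (n + 1)) * ((f (n + 1) - f n) / τ n)
            + (1 / 2) * (s - t (n + 1)) * (s - t n) * secondDiff τ f n)
          + pPoly τ t n s * (A * secondDiff τ u n - secondDiff τ f n)) := by
  intro s _
  refine ⟨deriv_quadratic_reconstruction_sub hτ htrec hCN1 hn s, ?_⟩
  have h := deriv_quadratic_reconstruction_sub hτ htrec (w := v) (z := fun k => f k - A * u k)
    (fun k => by linear_combination hCN2 k) hn s
  rw [secondDiff_sub_const_mul] at h
  linear_combination h
end

section
/- Let a < b be real numbers and c ≥ 0. Then ∫_a^b | (c/2)(t − (a + b)/2) + ½(t − b)(t − a) | dt ≤ (b − a)³/12 + c·(b − a)²/8. In particular, with a = t_n, b = t_{n+1}, c = τ_{n−1}, the function p_n(t) = (τ_{n−1}/2)(t − t_{n+1/2}) + ½(t − t_{n+1})(t − t_n) appearing in the residual of the quadratic reconstruction satisfies ∫_{t_n}^{t_{n+1}} |p_n(t)| dt ≤ τ_n³/12 + τ_{n−1}τ_n²/8. -/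
theorem integral_sub_mul_sub (a b : ℝ) :
    ∫ t in a..b, (b - t) * (t - a) = (b - a) ^ 3 / 6 := by
  have hderiv : ∀ t ∈ Set.uIcc a b,
      HasDerivAt (fun t => (b - a) * (t - a) ^ 2 / 2 - (t - a) ^ 3 / 3) ((b - t) * (t - a)) t := by
    intro t _
    have h := (hasDerivAt_id' t).sub_const a
    refine ((((h.pow 2).const_mul (b - a)).div_const 2).sub ((h.pow 3).div_const 3)).congr_deriv ?_
    push_cast
    ring
  rw [intervalIntegral.integral_eq_sub_of_hasDerivAt hderiv
    (Continuous.intervalIntegrable (by fun_prop) _ _)]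
  ring

theorem integral_abs_sub_midpoint {a b : ℝ} (hab : a ≤ b) :
    ∫ t in a..b, |t - (a + b) / 2| = (b - a) ^ 2 / 4 := by
  have hcont : Continuous fun t : ℝ => |t - (a + b) / 2| := by fun_prop
  have hleft : ∫ t in a..(a + b) / 2, |t - (a + b) / 2|
      = ∫ t in a..(a + b) / 2, ((a + b) / 2 - t) := by
    refine intervalIntegral.integral_congr fun t ht => ?_
    rw [Set.uIcc_of_le (by linarith)] at ht
    simp only [abs_of_nonpos (sub_nonpos.2 ht.2), neg_sub]
  have hright : ∫ t in (a + b) / 2..b, |t - (a + b) / 2|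
      = ∫ t in (a + b) / 2..b, (t - (a + b) / 2) := by
    refine intervalIntegral.integral_congr fun t ht => ?_
    rw [Set.uIcc_of_le (by linarith)] at ht
    exact abs_of_nonneg (sub_nonneg.2 ht.1)
  rw [← intervalIntegral.integral_add_adjacent_intervals
    (hcont.intervalIntegrable a ((a + b) / 2)) (hcont.intervalIntegrable _ b), hleft, hright,
    intervalIntegral.integral_sub (by simp) (by simp),
    intervalIntegral.integral_sub (by simp) (by simp)]
  simp only [integral_id, intervalIntegral.integral_const, smul_eq_mul]
  ring


/-- for `a < b` and `c ≥ 0`,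
`∫_a^b |(c/2)(t − (a+b)/2) + ½(t − b)(t − a)| dt ≤ (b − a)³/12 + c(b − a)²/8`.
With `a = t_n`, `b = t_{n+1}`, `c = τ_{n−1}` this bounds `∫ |p_n|` by
`τ_n³/12 + τ_{n−1} τ_n²/8`. -/
theorem pn_integral_bound (a b c : ℝ) (hab : a < b) (hc : 0 ≤ c) :
    (∫ t in a..b, |(c / 2) * (t - (a + b) / 2) + (1 / 2) * (t - b) * (t - a)|)
      ≤ (b - a) ^ 3 / 12 + c * (b - a) ^ 2 / 8 := by
  have hmono : (∫ t in a..b, |(c / 2) * (t - (a + b) / 2) + (1 / 2) * (t - b) * (t - a)|)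
      ≤ ∫ t in a..b, ((c / 2) * |t - (a + b) / 2| + (1 / 2) * ((b - t) * (t - a))) := by
    refine intervalIntegral.integral_mono_on hab.le
      (Continuous.intervalIntegrable (by fun_prop) _ _)
      (Continuous.intervalIntegrable (by fun_prop) _ _) fun t ht => ?_
    have hprod : 0 ≤ (b - t) * (t - a) :=
      mul_nonneg (sub_nonneg.2 ht.2) (sub_nonneg.2 ht.1)
    refine (abs_add_le _ _).trans_eq ?_
    rw [abs_mul, abs_of_nonneg (by positivity : 0 ≤ c / 2), abs_of_nonpos (by linarith : (1 / 2) * (t - b) * (t - a) ≤ 0)]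
    ring
  refine hmono.trans_eq ?_
  rw [intervalIntegral.integral_add (Continuous.intervalIntegrable (by fun_prop) _ _)
    (Continuous.intervalIntegrable (by fun_prop) _ _), intervalIntegral.integral_const_mul,
    intervalIntegral.integral_const_mul, integral_abs_sub_midpoint hab.le, integral_sub_mul_sub]
  ring
end

section
/- Let t_0 < t_1 < t_2 be real numbers, τ_0 = t_1 − t_0, τ_1 = t_2 − t_1, and define p_1(t) = (τ_0/2)(t − (t_1 + t_2)/2) + ½(t − t_2)(t − t_1). Then ∫_{t_0}^{t_1} |p_1(t)| dt ≤ (5/12)τ_0³ + (1/2)τ_1τ_0². -/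
/-- initial-interval bound. For `t_0 < t_1 < t_2`, `τ_0 = t_1 − t_0`,
`τ_1 = t_2 − t_1` and `p_1(t) = (τ_0/2)(t − (t_1 + t_2)/2) + ½(t − t_2)(t − t_1)`,
`∫_{t_0}^{t_1} |p_1(t)| dt ≤ (5/12)τ_0³ + (1/2)τ_1 τ_0²`. -/
theorem p1_initial_integral_bound (t0 t1 t2 : ℝ) (h01 : t0 < t1) (h12 : t1 < t2) :
    (∫ t in t0..t1,
        |((t1 - t0) / 2) * (t - (t1 + t2) / 2) + (1 / 2) * (t - t2) * (t - t1)|)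
      ≤ (5 / 12) * (t1 - t0) ^ 3 + (1 / 2) * (t2 - t1) * (t1 - t0) ^ 2 := by
  have hmono := intervalIntegral.integral_mono_on (μ := MeasureTheory.volume) h01.le
    (f := fun t => |((t1 - t0) / 2) * (t - (t1 + t2) / 2) + (1 / 2) * (t - t2) * (t - t1)|)
    (g := fun t => ((t1 - t0) / 2) * ((t1 + t2) / 2 - t) + (1 / 2) * (t - t2) * (t - t1))
    (Continuous.intervalIntegrable (by fun_prop) _ _)
    (Continuous.intervalIntegrable (by fun_prop) _ _)
    (fun t ht => by
      have hlin : 0 ≤ ((t1 - t0) / 2) * ((t1 + t2) / 2 - t) :=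
        mul_nonneg (by linarith) (by linarith [ht.2])
      have hquad : 0 ≤ (t2 - t) * (t1 - t) :=
        mul_nonneg (by linarith [ht.2]) (by linarith [ht.2])
      exact abs_le.mpr ⟨by linarith, by linarith⟩)
  refine hmono.trans_eq ?_
  rw [intervalIntegral.integral_eq_sub_of_hasDerivAt
    (f := fun t => ((t1 - t0) / 2) * ((t1 + t2) / 2 * t - t ^ 2 / 2)
      + (1 / 2) * (t ^ 3 / 3 - (t1 + t2) * (t ^ 2 / 2) + t1 * t2 * t))]
  · ring
  · intro t _
    have hsq : HasDerivAt (fun t : ℝ => t ^ 2 / 2) t t := by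
      simpa using (hasDerivAt_pow 2 t).div_const 2
    have hcube : HasDerivAt (fun t : ℝ => t ^ 3 / 3) (t ^ 2) t := by
      simpa using (hasDerivAt_pow 3 t).div_const 3
    exact (((((hasDerivAt_id t).const_mul ((t1 + t2) / 2)).sub hsq).const_mul
      ((t1 - t0) / 2)).add (((hcube.sub (hsq.const_mul (t1 + t2))).add
        ((hasDerivAt_id t).const_mul (t1 * t2))).const_mul (1 / 2))).congr_deriv (by ring)
  · exact Continuous.intervalIntegrable (by fun_prop) _ _
end
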